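/- arXiv:0909.3245 — 2 statements merged into one kernel-verified Lean document; each statement's English description precedes it below -/
import Mathlib

section
/- Let (ψ^ε_{θ s₁}, ψ^ε_{g s₂}, ^λφ^ε), ε = 1,…,q, be solutions of system (1.14) with all right-hand sides h_l ≡ 0 such that the q vectors (ψ^ε_{1 s₁},…,ψ^ε_{s₁ s₁}, ψ^ε_{1 s₂},…,ψ^ε_{s₂ s₂}, ^λφ^ε)(z,w) ∈ ℂ^{s₁+s₂+λ} are linearly independent at every point of a domain G′ ⊆ G, and suppose that for each ε the associated Pfaffian equation (1.18) has a nowhere-vanishing integrating factor μ_ε and a general integral F_ε of the form F_ε(ˢz,ᵏw) on G′. Then F₁,…,F_q are functionally independent first integrals on G′: each satisfies 𝔛_l F_ε = 0 (l = 1,…,2m), and the q×(s₁+s₂+λ) Jacobian matrix of (F₁,…,F_q) with respect to the variables z₁,…,z_{s₁}, z̄_{j₁},…,z̄_{j_{s₂}}, w₁,…,w_{k₁}, w̄_{ζ₁},…,w̄_{ζ_{k₂}} (formed with Wirtinger derivatives) has rank q at every point of G′. -/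
open Complex

noncomputable section

/-- Directional Wirtinger-type derivative along a complex coordinate line whose
"real" direction is `v` and "imaginary" direction is `iv`:
`(D_v f − i · D_{iv} f)/2`.  Taking `iv` to be the negative of the imaginary
direction produces the conjugate Wirtinger derivative `∂̄`. -/
def wirtD {E : Type*} [NormedAddCommGroup E] [NormedSpace ℝ E]
    (v iv : E) (f : E → ℂ) : E → ℂ :=
  fun p => (fderiv ℝ f p v - Complex.I * fderiv ℝ f p iv) / 2

/-- Wronskian of a finite family of functions with respect to the first-order
differential operator `D` (iterated derivatives down the rows). -/
def wronskO {E : Type*} (D : (E → ℂ) → E → ℂ) {p : ℕ} (u : Fin p → E → ℂ)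
    (x : E) : ℂ :=
  Matrix.det (Matrix.of fun i q : Fin p => D^[(i : ℕ)] (u q) x)

variable {m n : ℕ}

/-- The phase space of the total differential system (1.1). -/
abbrev TD (m n : ℕ) := (Fin m → ℂ) × (Fin n → ℂ)

/-- Wirtinger derivative `∂_{z_j}`. -/
def Dz (j : Fin m) : (TD m n → ℂ) → TD m n → ℂ :=
  wirtD (Pi.single j 1, 0) (Pi.single j Complex.I, 0)

/-- Wirtinger derivative `∂_{z̄_j}`. -/
def Dzbar (j : Fin m) : (TD m n → ℂ) → TD m n → ℂ :=
  wirtD (Pi.single j 1, 0) (-Pi.single j Complex.I, 0)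

/-- Wirtinger derivative `∂_{w_ξ}`. -/
def Dw (ξ : Fin n) : (TD m n → ℂ) → TD m n → ℂ :=
  wirtD (0, Pi.single ξ 1) (0, Pi.single ξ Complex.I)

/-- Wirtinger derivative `∂_{w̄_ξ}`. -/
def Dwbar (ξ : Fin n) : (TD m n → ℂ) → TD m n → ℂ :=
  wirtD (0, Pi.single ξ 1) (0, -Pi.single ξ Complex.I)

/-- The operator `𝔛_j` associated with system (1.1). -/
def Xop (X1 X2 : Fin n → Fin m → TD m n → ℂ) (j : Fin m) (F : TD m n → ℂ) :
    TD m n → ℂ :=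
  fun x => Dz j F x + ∑ ξ : Fin n,
    (X1 ξ j x * Dw ξ F x + (starRingEnd ℂ) (X2 ξ j x) * Dwbar ξ F x)

/-- The operator `𝔛_{m+j}` associated with system (1.1). -/
def XopBar (X1 X2 : Fin n → Fin m → TD m n → ℂ) (j : Fin m) (F : TD m n → ℂ) :
    TD m n → ℂ :=
  fun x => Dzbar j F x + ∑ ξ : Fin n,
    (X2 ξ j x * Dw ξ F x + (starRingEnd ℂ) (X1 ξ j x) * Dwbar ξ F x)

/-- All `2m` operators `𝔛_l`, `l = 1,…,2m`, indexed by `Fin m ⊕ Fin m`. -/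
def Xtot (X1 X2 : Fin n → Fin m → TD m n → ℂ) :
    Fin m ⊕ Fin m → (TD m n → ℂ) → TD m n → ℂ :=
  Sum.elim (Xop X1 X2) (XopBar X1 X2)

/-- The divergences `div 𝔛_l`, `l = 1,…,2m`. -/
def divX (X1 X2 : Fin n → Fin m → TD m n → ℂ) : Fin m ⊕ Fin m → TD m n → ℂ :=
  Sum.elim
    (fun j x => ∑ ξ : Fin n,
      (Dw ξ (X1 ξ j) x + Dwbar ξ (fun y => (starRingEnd ℂ) (X2 ξ j y)) x))
    (fun j x => ∑ ξ : Fin n,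
      (Dw ξ (X2 ξ j) x + Dwbar ξ (fun y => (starRingEnd ℂ) (X1 ξ j y)) x))

/-- `f` is of the form `f(ˢz, ᵏw)`: it is `(s₁,s₂)`-nonautonomous and
`(n−k₁,n−k₂)`-cylindrical, i.e. the Wirtinger derivatives with respect to all
omitted variables vanish on `S`. -/
def IsForm (s₁ s₂ k₁ k₂ : ℕ) (jp : Equiv.Perm (Fin m)) (ζp : Equiv.Perm (Fin n))
    (S : Set (TD m n)) (f : TD m n → ℂ) : Prop :=
  (∀ α : Fin m, s₁ ≤ (α : ℕ) → ∀ x ∈ S, Dz α f x = 0) ∧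
  (∀ β : Fin m, s₂ ≤ (β : ℕ) → ∀ x ∈ S, Dzbar (jp β) f x = 0) ∧
  (∀ γ : Fin n, k₁ ≤ (γ : ℕ) → ∀ x ∈ S, Dw γ f x = 0) ∧
  (∀ δ : Fin n, k₂ ≤ (δ : ℕ) → ∀ x ∈ S, Dwbar (ζp δ) f x = 0)

/-- The `w`-coordinate corresponding to the `i`-th component of `^λX^j`:
`w_i` for `i < k₁`, and `w_{ζ_{i−k₁}}` for the remaining `k₂` components. -/
def wIdx (k₁ k₂ : ℕ) (hk₁ : k₁ ≤ n) (hk₂ : k₂ ≤ n) (ζp : Equiv.Perm (Fin n))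
    (i : Fin (k₁ + k₂)) : Fin n :=
  if h : (i : ℕ) < k₁ then ⟨(i : ℕ), h.trans_le hk₁⟩
  else ζp ⟨(i : ℕ) - k₁, by have := i.isLt; omega⟩

/-- The vector function `^λX^j = (X_{1j},…,X_{k₁j}, conj X_{ζ₁,m+j},…,conj X_{ζ_{k₂},m+j})`. -/
def lamX (k₁ k₂ : ℕ) (hk₁ : k₁ ≤ n) (hk₂ : k₂ ≤ n) (ζp : Equiv.Perm (Fin n))
    (X1 X2 : Fin n → Fin m → TD m n → ℂ) (j : Fin m) (i : Fin (k₁ + k₂)) :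
    TD m n → ℂ :=
  fun x => if (i : ℕ) < k₁ then X1 (wIdx k₁ k₂ hk₁ hk₂ ζp i) j x
    else (starRingEnd ℂ) (X2 (wIdx k₁ k₂ hk₁ hk₂ ζp i) j x)

/-- The vector function `^λX^{m+j} = (X_{1,m+j},…,X_{k₁,m+j}, conj X_{ζ₁ j},…,conj X_{ζ_{k₂} j})`. -/
def lamX2 (k₁ k₂ : ℕ) (hk₁ : k₁ ≤ n) (hk₂ : k₂ ≤ n) (ζp : Equiv.Perm (Fin n))
    (X1 X2 : Fin n → Fin m → TD m n → ℂ) (j : Fin m) (i : Fin (k₁ + k₂)) :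
    TD m n → ℂ :=
  fun x => if (i : ℕ) < k₁ then X2 (wIdx k₁ k₂ hk₁ hk₂ ζp i) j x
    else (starRingEnd ℂ) (X1 (wIdx k₁ k₂ hk₁ hk₂ ζp i) j x)

/-- The Wirtinger derivative corresponding to the `i`-th retained `w`-variable:
`∂_{w_i}` for `i < k₁`, `∂_{w̄_{ζ_{i−k₁}}}` otherwise. -/
def wVarOp (k₁ k₂ : ℕ) (hk₁ : k₁ ≤ n) (hk₂ : k₂ ≤ n) (ζp : Equiv.Perm (Fin n))
    (i : Fin (k₁ + k₂)) : (TD m n → ℂ) → TD m n → ℂ :=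
  if (i : ℕ) < k₁ then Dw (wIdx k₁ k₂ hk₁ hk₂ ζp i)
  else Dwbar (wIdx k₁ k₂ hk₁ hk₂ ζp i)

/-- `D` is the Wirtinger derivative with respect to one of the omitted
variables `χ`. -/
def IsOmittedOp (s₁ s₂ k₁ k₂ : ℕ) (jp : Equiv.Perm (Fin m))
    (ζp : Equiv.Perm (Fin n)) (D : (TD m n → ℂ) → TD m n → ℂ) : Prop :=
  (∃ α : Fin m, s₁ ≤ (α : ℕ) ∧ D = Dz α) ∨
  (∃ β : Fin m, s₂ ≤ (β : ℕ) ∧ D = Dzbar (jp β)) ∨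
  (∃ γ : Fin n, k₁ ≤ (γ : ℕ) ∧ D = Dw γ) ∨
  (∃ δ : Fin n, k₂ ≤ (δ : ℕ) ∧ D = Dwbar (ζp δ))

/-- `f` is a partial integral of system (1.1) on `S`. -/
def PartialIntegral (X1 X2 : Fin n → Fin m → TD m n → ℂ) (S : Set (TD m n))
    (f : TD m n → ℂ) : Prop :=
  ∃ Φ : (Fin m ⊕ Fin m) → ℂ → TD m n → ℂ,
    (∀ l x, Φ l 0 x = 0) ∧ ∀ l, ∀ x ∈ S, Xtot X1 X2 l f x = Φ l (f x) x

/-- `F` is a first integral of system (1.1) on `S`. -/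
def FirstIntegral (X1 X2 : Fin n → Fin m → TD m n → ℂ) (S : Set (TD m n))
    (F : TD m n → ℂ) : Prop :=
  ∀ l, ∀ x ∈ S, Xtot X1 X2 l F x = 0

/-- `μ` is a last multiplier of system (1.1) on `S`. -/
def LastMultiplier (X1 X2 : Fin n → Fin m → TD m n → ℂ) (S : Set (TD m n))
    (μ : TD m n → ℂ) : Prop :=
  ∀ l, ∀ x ∈ S, Xtot X1 X2 l μ x = -(μ x * divX X1 X2 l x)

/-- System (1.14) with data `(ψ1, ψ2, φ)` and right-hand sides `h`. -/
def System114 (s₁ s₂ k₁ k₂ : ℕ) (hk₁ : k₁ ≤ n) (hk₂ : k₂ ≤ n)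
    (jp : Equiv.Perm (Fin m)) (ζp : Equiv.Perm (Fin n))
    (X1 X2 : Fin n → Fin m → TD m n → ℂ) (G : Set (TD m n))
    (ψ1 ψ2 : Fin m → TD m n → ℂ) (φ : Fin (k₁ + k₂) → TD m n → ℂ)
    (h : Fin m ⊕ Fin m → TD m n → ℂ) : Prop :=
  (∀ x ∈ G,
    (∀ θ : Fin m, (θ : ℕ) < s₁ →
      ψ1 θ x + ∑ i, φ i x * lamX k₁ k₂ hk₁ hk₂ ζp X1 X2 θ i x
        = h (Sum.inl θ) x) ∧
    (∀ η : Fin m, s₁ ≤ (η : ℕ) →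
      ∑ i, φ i x * lamX k₁ k₂ hk₁ hk₂ ζp X1 X2 η i x = h (Sum.inl η) x) ∧
    (∀ g : Fin m, (g : ℕ) < s₂ →
      ψ2 g x + ∑ i, φ i x * lamX2 k₁ k₂ hk₁ hk₂ ζp X1 X2 (jp g) i x
        = h (Sum.inr (jp g)) x) ∧
    (∀ ν : Fin m, s₂ ≤ (ν : ℕ) →
      ∑ i, φ i x * lamX2 k₁ k₂ hk₁ hk₂ ζp X1 X2 (jp ν) i x
        = h (Sum.inr (jp ν)) x)) ∧
  (∀ D, IsOmittedOp s₁ s₂ k₁ k₂ jp ζp D → ∀ x ∈ G,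
    (∀ θ : Fin m, (θ : ℕ) < s₁ → ∀ p, 1 ≤ p → p ≤ k₁ + k₂ →
      ∑ i, φ i x * D^[p] (lamX k₁ k₂ hk₁ hk₂ ζp X1 X2 θ i) x
        = D^[p] (h (Sum.inl θ)) x) ∧
    (∀ η : Fin m, s₁ ≤ (η : ℕ) → ∀ p, 1 ≤ p → p ≤ k₁ + k₂ - 1 →
      ∑ i, φ i x * D^[p] (lamX k₁ k₂ hk₁ hk₂ ζp X1 X2 η i) x
        = D^[p] (h (Sum.inl η)) x) ∧
    (∀ g : Fin m, (g : ℕ) < s₂ → ∀ p, 1 ≤ p → p ≤ k₁ + k₂ →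
      ∑ i, φ i x * D^[p] (lamX2 k₁ k₂ hk₁ hk₂ ζp X1 X2 (jp g) i) x
        = D^[p] (h (Sum.inr (jp g))) x) ∧
    (∀ ν : Fin m, s₂ ≤ (ν : ℕ) → ∀ p, 1 ≤ p → p ≤ k₁ + k₂ - 1 →
      ∑ i, φ i x * D^[p] (lamX2 k₁ k₂ hk₁ hk₂ ζp X1 X2 (jp ν) i) x
        = D^[p] (h (Sum.inr (jp ν))) x))

/-- `f` is a general integral of the Pfaffian equation (1.15)/(1.18) built from
`(ψ1, ψ2, φ)`, with integrating factor `μ` (the relations (1.16)). -/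
def PfaffGeneral (s₁ s₂ k₁ k₂ : ℕ) (hk₁ : k₁ ≤ n) (hk₂ : k₂ ≤ n)
    (jp : Equiv.Perm (Fin m)) (ζp : Equiv.Perm (Fin n)) (S : Set (TD m n))
    (ψ1 ψ2 : Fin m → TD m n → ℂ) (φ : Fin (k₁ + k₂) → TD m n → ℂ)
    (μ f : TD m n → ℂ) : Prop :=
  (∀ θ : Fin m, (θ : ℕ) < s₁ → ∀ x ∈ S, Dz θ f x = μ x * ψ1 θ x) ∧
  (∀ g : Fin m, (g : ℕ) < s₂ → ∀ x ∈ S, Dzbar (jp g) f x = μ x * ψ2 g x) ∧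
  (∀ i : Fin (k₁ + k₂), ∀ x ∈ S, wVarOp k₁ k₂ hk₁ hk₂ ζp i f x = μ x * φ i x)

/-- The Wirtinger derivative with respect to the `c`-th of the
`s₁ + s₂ + (k₁+k₂)` retained variables
`z₁,…,z_{s₁}, z̄_{j₁},…,z̄_{j_{s₂}}, w₁,…,w_{k₁}, w̄_{ζ₁},…,w̄_{ζ_{k₂}}`. -/
def allVarOp (s₁ s₂ k₁ k₂ : ℕ) (hs₁ : s₁ ≤ m) (hs₂ : s₂ ≤ m)
    (hk₁ : k₁ ≤ n) (hk₂ : k₂ ≤ n)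
    (jp : Equiv.Perm (Fin m)) (ζp : Equiv.Perm (Fin n))
    (c : Fin (s₁ + s₂ + (k₁ + k₂))) : (TD m n → ℂ) → TD m n → ℂ :=
  if h : (c : ℕ) < s₁ then Dz ⟨(c : ℕ), h.trans_le hs₁⟩
  else if h2 : (c : ℕ) < s₁ + s₂ then Dzbar (jp ⟨(c : ℕ) - s₁, by omega⟩)
  else wVarOp k₁ k₂ hk₁ hk₂ ζp ⟨(c : ℕ) - (s₁ + s₂), by have := c.isLt; omega⟩

/-- The vector `(ψ_{1 s₁},…,ψ_{s₁ s₁}, ψ_{1 s₂},…,ψ_{s₂ s₂}, ^λφ)(x) ∈ ℂ^{s₁+s₂+λ}`. -/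
def solVec (s₁ s₂ k₁ k₂ : ℕ) (hs₁ : s₁ ≤ m) (hs₂ : s₂ ≤ m)
    (ψ1 ψ2 : Fin m → TD m n → ℂ) (φ : Fin (k₁ + k₂) → TD m n → ℂ)
    (x : TD m n) (c : Fin (s₁ + s₂ + (k₁ + k₂))) : ℂ :=
  if h : (c : ℕ) < s₁ then ψ1 ⟨(c : ℕ), h.trans_le hs₁⟩ x
  else if h2 : (c : ℕ) < s₁ + s₂ then ψ2 ⟨(c : ℕ) - s₁, by omega⟩ x
  else φ ⟨(c : ℕ) - (s₁ + s₂), by have := c.isLt; omega⟩ x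

/-- A sum over `Fin n` whose terms vanish from index `k` on is a sum over `Fin k`. -/
theorem Fin.sum_eq_sum_castLE_of_eq_zero {M : Type*} [AddCommMonoid M] {k n : ℕ} (hk : k ≤ n)
    (g : Fin n → M) (hg : ∀ i : Fin n, k ≤ (i : ℕ) → g i = 0) :
    ∑ i, g i = ∑ i : Fin k, g (Fin.castLE hk i) := by
  obtain ⟨d, rfl⟩ := Nat.exists_eq_add_of_le hk
  rw [Fin.sum_univ_add, Finset.sum_eq_zero (s := Finset.univ)
    (f := fun i : Fin d => g (Fin.natAdd k i)) fun i _ => hg _ (by simp), add_zero]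
  rfl

/-- For a function of the form `f(ˢz, ᵏw)`, a first-order operator in all the `w`-variables
reduces to the retained ones. -/
theorem IsForm.sum_Dw_add_Dwbar {m n s₁ s₂ k₁ k₂ : ℕ} (hk₁ : k₁ ≤ n) (hk₂ : k₂ ≤ n)
    {jp : Equiv.Perm (Fin m)} {ζp : Equiv.Perm (Fin n)} {S : Set (TD m n)} {f : TD m n → ℂ}
    (hf : IsForm s₁ s₂ k₁ k₂ jp ζp S f) {x : TD m n} (hx : x ∈ S) (a b : Fin n → ℂ) :
    ∑ ξ, (a ξ * Dw ξ f x + b ξ * Dwbar ξ f x) =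
      ∑ i : Fin (k₁ + k₂), wVarOp k₁ k₂ hk₁ hk₂ ζp i f x *
        (if (i : ℕ) < k₁ then a (wIdx k₁ k₂ hk₁ hk₂ ζp i)
          else b (wIdx k₁ k₂ hk₁ hk₂ ζp i)) := by
  obtain ⟨-, -, hw, hwbar⟩ := hf
  rw [Finset.sum_add_distrib, Fin.sum_univ_add,
    ← Equiv.sum_comp ζp fun ξ => b ξ * Dwbar ξ f x,
    Fin.sum_eq_sum_castLE_of_eq_zero hk₁ _ fun i hi => by rw [hw i hi x hx, mul_zero],
    Fin.sum_eq_sum_castLE_of_eq_zero hk₂ _ fun i hi => by rw [hwbar i hi x hx, mul_zero]]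
  congr 1 <;> refine Finset.sum_congr rfl fun i _ => ?_
  · have : wIdx k₁ k₂ hk₁ hk₂ ζp (Fin.castAdd k₂ i) = Fin.castLE hk₁ i := by
      simp [wIdx, Fin.ext_iff]
    simp [wVarOp, this, mul_comm]
  · have : wIdx k₁ k₂ hk₁ hk₂ ζp (Fin.natAdd k₁ i) = ζp (Fin.castLE hk₂ i) := by
      simp [wIdx, Fin.castLE]
    simp [wVarOp, this, mul_comm]

/-- A general integral of the Pfaffian equation built from a solution of the homogeneous
system is a first integral. -/
theorem PfaffGeneral.firstIntegral {m n s₁ s₂ k₁ k₂ : ℕ} {hk₁ : k₁ ≤ n} {hk₂ : k₂ ≤ n}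
    {jp : Equiv.Perm (Fin m)} {ζp : Equiv.Perm (Fin n)} {G S : Set (TD m n)} (hS : S ⊆ G)
    {X1 X2 : Fin n → Fin m → TD m n → ℂ} {ψ1 ψ2 : Fin m → TD m n → ℂ}
    {φ : Fin (k₁ + k₂) → TD m n → ℂ} {μ f : TD m n → ℂ}
    (hsys : System114 s₁ s₂ k₁ k₂ hk₁ hk₂ jp ζp X1 X2 G ψ1 ψ2 φ (fun _ _ => 0))
    (hform : IsForm s₁ s₂ k₁ k₂ jp ζp S f)
    (hgen : PfaffGeneral s₁ s₂ k₁ k₂ hk₁ hk₂ jp ζp S ψ1 ψ2 φ μ f) :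
    FirstIntegral X1 X2 S f := by
  obtain ⟨hz, hzbar, hw⟩ := hgen
  have sum_eq (x : TD m n) (hx : x ∈ S) (c : Fin (k₁ + k₂) → ℂ) :
      ∑ i, wVarOp k₁ k₂ hk₁ hk₂ ζp i f x * c i = μ x * ∑ i, φ i x * c i := by
    simp_rw [hw _ x hx, mul_assoc, ← Finset.mul_sum]
  rintro (j | j) x hx <;> obtain ⟨h₁, h₂, h₃, h₄⟩ := hsys.1 x (hS hx)
  · change Dz j f x + ∑ ξ, _ = 0
    rw [hform.sum_Dw_add_Dwbar hk₁ hk₂ hx (fun ξ => X1 ξ j x)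
      (fun ξ => (starRingEnd ℂ) (X2 ξ j x)), sum_eq x hx]
    rcases lt_or_ge (j : ℕ) s₁ with hj | hj
    · rw [hz j hj x hx, ← mul_add]
      exact mul_eq_zero_of_right _ (h₁ j hj)
    · rw [hform.1 j hj x hx, zero_add]
      exact mul_eq_zero_of_right _ (h₂ j hj)
  · change Dzbar j f x + ∑ ξ, _ = 0
    rw [hform.sum_Dw_add_Dwbar hk₁ hk₂ hx (fun ξ => X2 ξ j x)
      (fun ξ => (starRingEnd ℂ) (X1 ξ j x)), sum_eq x hx]
    obtain ⟨g, rfl⟩ := jp.surjective j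
    rcases lt_or_ge (g : ℕ) s₂ with hg | hg
    · rw [hzbar g hg x hx, ← mul_add]
      exact mul_eq_zero_of_right _ (h₃ g hg)
    · rw [hform.2.1 g hg x hx, zero_add]
      exact mul_eq_zero_of_right _ (h₄ g hg)

/-- The retained Wirtinger derivatives of a general integral are the coefficients of the
Pfaffian equation multiplied by the integrating factor. -/
theorem PfaffGeneral.allVarOp_eq {m n s₁ s₂ k₁ k₂ : ℕ} (hs₁ : s₁ ≤ m) (hs₂ : s₂ ≤ m)
    {hk₁ : k₁ ≤ n} {hk₂ : k₂ ≤ n} {jp : Equiv.Perm (Fin m)} {ζp : Equiv.Perm (Fin n)}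
    {S : Set (TD m n)} {ψ1 ψ2 : Fin m → TD m n → ℂ} {φ : Fin (k₁ + k₂) → TD m n → ℂ}
    {μ f : TD m n → ℂ} (hgen : PfaffGeneral s₁ s₂ k₁ k₂ hk₁ hk₂ jp ζp S ψ1 ψ2 φ μ f)
    {x : TD m n} (hx : x ∈ S) (c : Fin (s₁ + s₂ + (k₁ + k₂))) :
    allVarOp s₁ s₂ k₁ k₂ hs₁ hs₂ hk₁ hk₂ jp ζp c f x =
      μ x * solVec s₁ s₂ k₁ k₂ hs₁ hs₂ ψ1 ψ2 φ x c := by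
  obtain ⟨hz, hzbar, hw⟩ := hgen
  unfold allVarOp solVec
  split_ifs with h h2
  · exact hz _ h x hx
  · exact hzbar _ (by change (c : ℕ) - s₁ < s₂; omega) x hx
  · exact hw _ x hx

/-- **Theorem 1.8.** If `(ψ^ε_{θs₁}, ψ^ε_{gs₂}, ^λφ^ε)`, `ε = 1,…,q`, are
solutions of system (1.14) with all right-hand sides `h_l ≡ 0` whose value
vectors in `ℂ^{s₁+s₂+λ}` are linearly independent at every point of `G′`, and
for each `ε` the associated Pfaffian equation (1.18) has a nowhere-vanishing
integrating factor `μ_ε` and a general integral `F_ε` of the form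
`F_ε(ˢz,ᵏw)` on `G′`, then `F₁,…,F_q` are functionally independent first
integrals of (1.1) on `G′`. -/
theorem statement_7 {m n : ℕ} (s₁ s₂ k₁ k₂ : ℕ) (hs₁ : s₁ ≤ m) (hs₂ : s₂ ≤ m)
    (hk₁ : k₁ ≤ n) (hk₂ : k₂ ≤ n)
    (jp : Equiv.Perm (Fin m)) (ζp : Equiv.Perm (Fin n))
    (G G' : Set (TD m n)) (hGo : IsOpen G) (hGc : IsConnected G)
    (hG'o : IsOpen G') (hG'c : IsConnected G') (hsub : G' ⊆ G)
    (X1 X2 : Fin n → Fin m → TD m n → ℂ)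
    (hX1 : ∀ ξ j, ∀ x ∈ G, DifferentiableAt ℝ (X1 ξ j) x)
    (hX2 : ∀ ξ j, ∀ x ∈ G, DifferentiableAt ℝ (X2 ξ j) x)
    (q : ℕ) (ψ1 ψ2 : Fin q → Fin m → TD m n → ℂ)
    (φ : Fin q → Fin (k₁ + k₂) → TD m n → ℂ)
    (hforms : ∀ ε : Fin q,
      (∀ θ : Fin m, (θ : ℕ) < s₁ → IsForm s₁ s₂ k₁ k₂ jp ζp G (ψ1 ε θ)) ∧
      (∀ g : Fin m, (g : ℕ) < s₂ → IsForm s₁ s₂ k₁ k₂ jp ζp G (ψ2 ε g)) ∧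
      (∀ i : Fin (k₁ + k₂), IsForm s₁ s₂ k₁ k₂ jp ζp G (φ ε i)))
    (hsys : ∀ ε : Fin q, System114 s₁ s₂ k₁ k₂ hk₁ hk₂ jp ζp X1 X2 G
      (ψ1 ε) (ψ2 ε) (φ ε) (fun _ _ => 0))
    (hli : ∀ x ∈ G', LinearIndependent ℂ
      (fun ε : Fin q => solVec s₁ s₂ k₁ k₂ hs₁ hs₂ (ψ1 ε) (ψ2 ε) (φ ε) x))
    (μ : Fin q → TD m n → ℂ) (hμ0 : ∀ ε, ∀ x ∈ G', μ ε x ≠ 0)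
    (F : Fin q → TD m n → ℂ)
    (hFd : ∀ ε, ∀ x ∈ G', DifferentiableAt ℝ (F ε) x)
    (hFform : ∀ ε, IsForm s₁ s₂ k₁ k₂ jp ζp G' (F ε))
    (hgen : ∀ ε, PfaffGeneral s₁ s₂ k₁ k₂ hk₁ hk₂ jp ζp G'
      (ψ1 ε) (ψ2 ε) (φ ε) (μ ε) (F ε)) :
    (∀ ε, FirstIntegral X1 X2 G' (F ε)) ∧
    ∀ x ∈ G', (Matrix.of fun (ε : Fin q) (c : Fin (s₁ + s₂ + (k₁ + k₂))) =>
      allVarOp s₁ s₂ k₁ k₂ hs₁ hs₂ hk₁ hk₂ jp ζp c (F ε) x).rank = q := by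
  refine ⟨fun ε => (hgen ε).firstIntegral hsub (hsys ε) (hFform ε), fun x hx => ?_⟩
  have hrow : (fun ε c => allVarOp s₁ s₂ k₁ k₂ hs₁ hs₂ hk₁ hk₂ jp ζp c (F ε) x) =
      (fun ε => Units.mk0 (μ ε x) (hμ0 ε x hx)) •
        fun ε => solVec s₁ s₂ k₁ k₂ hs₁ hs₂ (ψ1 ε) (ψ2 ε) (φ ε) x :=
    funext₂ fun ε c => (hgen ε).allVarOp_eq hs₁ hs₂ hx c
  rw [hrow]
  exact ((hli x hx).units_smul _).rank_matrix.trans (Fintype.card_fin q)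
end
end

section
/- Let the system (2.25) be Jacobian. Let ν⁰ ∈ ℂ^{2n} be a nonzero common eigenvector of A₁,…,A_m, with A_j ν⁰ = λ^j ν⁰ for j = 1,…,m. Fix ζ ∈ {1,…,m} and an integer s ≥ 2, and let ν^η ∈ ℂ^{2n} (η = 1,…,s−1) be generalized eigenvectors of A_ζ for λ^ζ: (A_ζ − λ^ζ I) ν^η = η ν^{η−1}. Let Ω be a domain contained in { z ∈ ℂ^n : ν⁰·γ(z) ≠ 0 }, and let Ψ_η : Ω → ℂ (η = 1,…,s−1) be the unique solution of the triangular system ν^η·γ = Σ_{δ=1}^{η} C(η−1, δ−1) · Ψ_δ · (ν^{η−δ}·γ) on Ω for η = 1,…,s−1, where C(·,·) denotes binomial coefficients. Assume that none of the functions 𝔏_j Ψ_η (j = 1,…,m with j ≠ ζ; η = 1,…,s−1) is a nonconstant first integral of the single equation 𝔏_ζ w = 0 on Ω. Then 𝔏_ζ Ψ₁ = 1 on Ω, 𝔏_ζ Ψ_η = 0 on Ω for η = 2,…,s−1, and for every j ≠ ζ and every η = 1,…,s−1 the function 𝔏_j Ψ_η is constant on Ω. -/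
open Complex

noncomputable section

variable {n m : ℕ}

/-- Wirtinger derivative `∂_{z_ξ}` on `ℂ^n`. -/
def DzV (ξ : Fin n) : ((Fin n → ℂ) → ℂ) → (Fin n → ℂ) → ℂ :=
  wirtD (Pi.single ξ 1) (Pi.single ξ Complex.I)

/-- Wirtinger derivative `∂_{z̄_ξ}` on `ℂ^n`. -/
def DzbarV (ξ : Fin n) : ((Fin n → ℂ) → ℂ) → (Fin n → ℂ) → ℂ :=
  wirtD (Pi.single ξ 1) (-Pi.single ξ Complex.I)

/-- `γ(z) = (z₁,…,z_n, z̄₁,…,z̄_n)`, indexed by `Fin n ⊕ Fin n`. -/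
def gam (z : Fin n → ℂ) : Fin n ⊕ Fin n → ℂ :=
  Sum.elim z fun ξ => (starRingEnd ℂ) (z ξ)

/-- `b·γ(z) = ∑ l b_l γ(z)_l`. -/
def dotg (b : Fin n ⊕ Fin n → ℂ) (z : Fin n → ℂ) : ℂ :=
  ∑ l, b l * gam z l

/-- The linear map `A_j : ℂ^{2n} → ℂ^{2n}`, `(A_j b)_l = ∑_k a_{jkl} b_k`. -/
def Amap (a : Fin m → (Fin n ⊕ Fin n) → (Fin n ⊕ Fin n) → ℂ) (j : Fin m)
    (b : Fin n ⊕ Fin n → ℂ) : Fin n ⊕ Fin n → ℂ :=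
  fun l => ∑ k, a j k l * b k

/-- The operator `𝔏_j` of system (2.25), with ℝ-linear coefficients
`a_{jk}(z) = ∑_τ a_{jkτ} γ(z)_τ`. -/
def Lop (a : Fin m → (Fin n ⊕ Fin n) → (Fin n ⊕ Fin n) → ℂ) (j : Fin m)
    (F : (Fin n → ℂ) → ℂ) : (Fin n → ℂ) → ℂ :=
  fun z => ∑ ξ : Fin n,
    ((∑ τ, a j (Sum.inl ξ) τ * gam z τ) * DzV ξ F z +
     (∑ τ, a j (Sum.inr ξ) τ * gam z τ) * DzbarV ξ F z)

/-- The system (2.25) is Jacobian: all Poisson brackets `[𝔏_j, 𝔏_ζ]`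
vanish. -/
def Jacobian (a : Fin m → (Fin n ⊕ Fin n) → (Fin n ⊕ Fin n) → ℂ) : Prop :=
  ∀ j ζ : Fin m, ∀ F : (Fin n → ℂ) → ℂ, ContDiff ℝ (⊤ : ℕ∞) F →
    ∀ z, Lop a j (Lop a ζ F) z = Lop a ζ (Lop a j F) z

section LinearSystem

open Filter Topology

/-- The real-linear functional `z ↦ b·γ(z)`. -/
def dotgCLM (b : Fin n ⊕ Fin n → ℂ) : (Fin n → ℂ) →L[ℝ] ℂ :=
  LinearMap.toContinuousLinearMap
    { toFun := dotg b
      map_add' := fun x y => by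
        simp [dotg, gam, mul_add, Finset.sum_add_distrib]
        ring
      map_smul' := fun r x => by
        simp [dotg, gam, Finset.mul_sum, mul_left_comm] }

theorem dotg_add (b c : Fin n ⊕ Fin n → ℂ) (z : Fin n → ℂ) :
    dotg (b + c) z = dotg b z + dotg c z := by
  simp only [dotg, Pi.add_apply, add_mul, Finset.sum_add_distrib]

theorem dotg_smul (r : ℂ) (b : Fin n ⊕ Fin n → ℂ) (z : Fin n → ℂ) :
    dotg (r • b) z = r * dotg b z := by
  simp only [dotg, Pi.smul_apply, smul_eq_mul, mul_assoc, Finset.mul_sum]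

theorem coe_dotgCLM (b : Fin n ⊕ Fin n → ℂ) : ⇑(dotgCLM b) = dotg b := rfl

theorem contDiff_dotg (b : Fin n ⊕ Fin n → ℂ) {N : WithTop ℕ∞} : ContDiff ℝ N (dotg b) :=
  coe_dotgCLM b ▸ (dotgCLM b).contDiff

theorem differentiable_dotg (b : Fin n ⊕ Fin n → ℂ) : Differentiable ℝ (dotg b) :=
  coe_dotgCLM b ▸ (dotgCLM b).differentiable

theorem fderiv_dotg (b : Fin n ⊕ Fin n → ℂ) (z v : Fin n → ℂ) :
    fderiv ℝ (dotg b) z v = dotg b v := by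
  rw [← coe_dotgCLM b, (dotgCLM b).fderiv]

theorem dotg_single (b : Fin n ⊕ Fin n → ℂ) (ξ : Fin n) (c : ℂ) :
    dotg b (Pi.single ξ c) = b (Sum.inl ξ) * c + b (Sum.inr ξ) * (starRingEnd ℂ) c := by
  simp [dotg, gam, Pi.single_apply, apply_ite (starRingEnd ℂ)]

theorem DzV_dotg (b : Fin n ⊕ Fin n → ℂ) (ξ : Fin n) (z : Fin n → ℂ) :
    DzV ξ (dotg b) z = b (Sum.inl ξ) := by
  simp only [DzV, wirtD, fderiv_dotg, dotg_single, map_one, conj_I]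
  linear_combination (-(b (Sum.inl ξ)) / 2 + b (Sum.inr ξ) / 2) * I_mul_I

theorem DzbarV_dotg (b : Fin n ⊕ Fin n → ℂ) (ξ : Fin n) (z : Fin n → ℂ) :
    DzbarV ξ (dotg b) z = b (Sum.inr ξ) := by
  simp only [DzbarV, wirtD, map_neg, fderiv_dotg, dotg_single, map_one, conj_I]
  linear_combination (b (Sum.inl ξ) / 2 - b (Sum.inr ξ) / 2) * I_mul_I

variable (a : Fin m → (Fin n ⊕ Fin n) → (Fin n ⊕ Fin n) → ℂ) (j : Fin m)

theorem Lop_dotg (b : Fin n ⊕ Fin n → ℂ) (z : Fin n → ℂ) :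
    Lop a j (dotg b) z = dotg (Amap a j b) z := by
  simp only [Lop, DzV_dotg, DzbarV_dotg, dotg, Amap, Finset.sum_add_distrib]
  rw [← Fintype.sum_sum_type (fun k => (∑ τ, a j k τ * gam z τ) * b k)]
  simp only [Finset.sum_mul]
  rw [Finset.sum_comm]
  exact Finset.sum_congr rfl fun l _ => Finset.sum_congr rfl fun k _ => by ring

theorem Lop_congr {F G : (Fin n → ℂ) → ℂ} {z : Fin n → ℂ} (h : F =ᶠ[𝓝 z] G) :
    Lop a j F z = Lop a j G z := by
  simp only [Lop, DzV, DzbarV, wirtD, h.fderiv_eq]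

theorem Lop_eventuallyEq {F G : (Fin n → ℂ) → ℂ} {z : Fin n → ℂ} (h : F =ᶠ[𝓝 z] G) :
    Lop a j F =ᶠ[𝓝 z] Lop a j G :=
  h.eventuallyEq_nhds.mono fun _ => Lop_congr a j

theorem Lop_const (c : ℂ) (z : Fin n → ℂ) : Lop a j (fun _ => c) z = 0 := by
  simp [Lop, DzV, DzbarV, wirtD]

theorem Lop_mul {F G : (Fin n → ℂ) → ℂ} {z : Fin n → ℂ}
    (hF : DifferentiableAt ℝ F z) (hG : DifferentiableAt ℝ G z) :
    Lop a j (fun w => F w * G w) z = Lop a j F z * G z + F z * Lop a j G z := by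
  simp only [Lop, DzV, DzbarV, wirtD, fderiv_fun_mul hF hG, add_apply,
    smul_apply, smul_eq_mul]
  rw [Finset.sum_mul, Finset.mul_sum, ← Finset.sum_add_distrib]
  exact Finset.sum_congr rfl fun ξ _ => by ring

theorem Lop_sum {ι : Type*} (t : Finset ι) {F : ι → (Fin n → ℂ) → ℂ} {z : Fin n → ℂ}
    (hF : ∀ i ∈ t, DifferentiableAt ℝ (F i) z) :
    Lop a j (fun w => ∑ i ∈ t, F i w) z = ∑ i ∈ t, Lop a j (F i) z := by
  simp only [Lop, DzV, DzbarV, wirtD, fderiv_fun_sum hF, sum_apply]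
  rw [Finset.sum_comm]
  refine Finset.sum_congr rfl fun ξ _ => ?_
  simp only [Finset.mul_sum, ← Finset.sum_sub_distrib, Finset.sum_div, ← Finset.sum_add_distrib]

variable {a} in
/-- Vanishing Poisson brackets may be tested on germs of smooth functions. -/
theorem Jacobian.comm_of_contDiffOn (hJac : Jacobian a) (j ζ : Fin m) {Ω : Set (Fin n → ℂ)}
    (hΩ : IsOpen Ω) {F : (Fin n → ℂ) → ℂ} (hF : ContDiffOn ℝ (⊤ : ℕ∞) F Ω)
    {z : Fin n → ℂ} (hz : z ∈ Ω) :
    Lop a j (Lop a ζ F) z = Lop a ζ (Lop a j F) z := by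
  obtain ⟨r, hr, hrΩ⟩ := Metric.nhds_basis_closedBall.mem_iff.1 (hΩ.mem_nhds hz)
  let f : ContDiffBump z := ⟨r / 2, r, half_pos hr, half_lt_self hr⟩
  let G : (Fin n → ℂ) → ℂ := fun w => f w • F w
  have hG : ContDiff ℝ (⊤ : ℕ∞) G := by
    refine contDiff_iff_contDiffAt.2 fun w => ?_
    by_cases hw : w ∈ Ω
    · exact f.contDiff.contDiffAt.smul (hF.contDiffAt (hΩ.mem_nhds hw))
    · have hw' : w ∉ tsupport f := fun h => hw (hrΩ (f.tsupport_eq ▸ h))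
      refine (contDiffAt_const (c := (0 : ℂ))).congr_of_eventuallyEq ?_
      filter_upwards [notMem_tsupport_iff_eventuallyEq.1 hw'] with x hx
      simp [G, hx]
  have hFG : F =ᶠ[𝓝 z] G := by
    filter_upwards [f.eventuallyEq_one] with x hx
    simp [G, hx]
  rw [Lop_congr a j (Lop_eventuallyEq a ζ hFG), Lop_congr a ζ (Lop_eventuallyEq a j hFG)]
  exact hJac j ζ G hG z

/-- Solutions of the triangular system are smooth where `ν⁰·γ` does not vanish. -/
theorem contDiffOn_of_triangular {N : ℕ} {ν : ℕ → Fin n ⊕ Fin n → ℂ} {Ω : Set (Fin n → ℂ)}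
    (hΩ : ∀ z ∈ Ω, dotg (ν 0) z ≠ 0) {Ψ : ℕ → (Fin n → ℂ) → ℂ}
    (hΨ : ∀ η, 1 ≤ η → η ≤ N → ∀ z ∈ Ω,
      dotg (ν η) z = ∑ δ ∈ Finset.Icc 1 η,
        (Nat.choose (η - 1) (δ - 1) : ℂ) * Ψ δ z * dotg (ν (η - δ)) z)
    {M : WithTop ℕ∞} (η : ℕ) (h1 : 1 ≤ η) (hN : η ≤ N) : ContDiffOn ℝ M (Ψ η) Ω := by
  induction η using Nat.strong_induction_on with
  | _ η ih =>
    obtain ⟨k, rfl⟩ : ∃ k, η = k + 1 := ⟨η - 1, by omega⟩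
    have key : ContDiffOn ℝ M (fun z => (dotg (ν (k + 1)) z - ∑ δ ∈ Finset.Icc 1 k,
        (Nat.choose k (δ - 1) : ℂ) * Ψ δ z * dotg (ν (k + 1 - δ)) z) * (dotg (ν 0) z)⁻¹) Ω := by
      refine ((contDiff_dotg _).contDiffOn.sub (ContDiffOn.sum fun δ hδ => ?_)).mul
        ((contDiff_dotg _).contDiffOn.inv hΩ)
      rw [Finset.mem_Icc] at hδ
      exact (contDiffOn_const.mul (ih δ (by omega) hδ.1 (by omega))).mul
        (contDiff_dotg _).contDiffOn
    refine key.congr fun z hz => ?_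
    have h := hΨ (k + 1) h1 hN z hz
    rw [Finset.sum_Icc_succ_top (by omega)] at h
    simp only [Nat.add_sub_cancel, Nat.choose_self, Nat.cast_one, one_mul, Nat.sub_self] at h
    rw [h, add_sub_cancel_left, mul_inv_cancel_right₀ (hΩ z hz)]

theorem choose_pred_mul_sub {η δ : ℕ} (hδ : 1 ≤ δ) (hδη : δ ≤ η) :
    ((η + 1 - 1).choose (δ - 1) : ℂ) * ((η + 1 - δ : ℕ) : ℂ) =
      η * ((η - 1).choose (δ - 1) : ℂ) := by
  obtain ⟨d, rfl⟩ : ∃ d, δ = d + 1 := ⟨δ - 1, by omega⟩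
  obtain ⟨k, rfl⟩ : ∃ k, η = k + 1 := ⟨η - 1, by omega⟩
  have h := Nat.choose_mul_succ_eq k d
  rw [mul_comm] at h
  simp only [Nat.add_sub_cancel]
  rw [show k + 1 + 1 - (d + 1) = k + 1 - d by omega]
  exact_mod_cast h.symm

/-- Applying `𝔏_ζ` to the triangular system yields a triangular system for `𝔏_ζ Ψ_η`. -/
theorem sum_choose_mul_Lop {ζ : Fin m} {N : ℕ} {ν : ℕ → Fin n ⊕ Fin n → ℂ} {lam : ℂ}
    (heig : Amap a ζ (ν 0) = lam • ν 0)
    (hgen : ∀ η, 1 ≤ η → η ≤ N → Amap a ζ (ν η) = lam • ν η + (η : ℂ) • ν (η - 1))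
    {Ω : Set (Fin n → ℂ)} (hΩo : IsOpen Ω) {Ψ : ℕ → (Fin n → ℂ) → ℂ}
    (hdiff : ∀ η, 1 ≤ η → η ≤ N → DifferentiableOn ℝ (Ψ η) Ω)
    (hΨ : ∀ η, 1 ≤ η → η ≤ N → ∀ z ∈ Ω,
      dotg (ν η) z = ∑ δ ∈ Finset.Icc 1 η,
        (Nat.choose (η - 1) (δ - 1) : ℂ) * Ψ δ z * dotg (ν (η - δ)) z)
    {η : ℕ} (hη : 1 ≤ η) (hN : η ≤ N) {z : Fin n → ℂ} (hz : z ∈ Ω) :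
    ∑ δ ∈ Finset.Icc 1 η, (Nat.choose (η - 1) (δ - 1) : ℂ) * Lop a ζ (Ψ δ) z *
      dotg (ν (η - δ)) z = dotg (ν (η - 1)) z := by
  have hL : ∀ k ≤ N, Lop a ζ (dotg (ν k)) z =
      lam * dotg (ν k) z + k * dotg (ν (k - 1)) z := by
    intro k hk
    rw [Lop_dotg]
    rcases Nat.eq_zero_or_pos k with rfl | hk0
    · simp [heig, dotg_smul]
    · rw [hgen k hk0 hk, dotg_add, dotg_smul, dotg_smul]
  have hd : ∀ δ ∈ Finset.Icc 1 η, DifferentiableAt ℝ (Ψ δ) z := fun δ hδ => by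
    rw [Finset.mem_Icc] at hδ
    exact (hdiff δ hδ.1 (hδ.2.trans hN)).differentiableAt (hΩo.mem_nhds hz)
  have hLη : Lop a ζ (dotg (ν η)) z = ∑ δ ∈ Finset.Icc 1 η,
      ((Nat.choose (η - 1) (δ - 1) : ℂ) * Lop a ζ (Ψ δ) z * dotg (ν (η - δ)) z +
        (lam * ((Nat.choose (η - 1) (δ - 1) : ℂ) * Ψ δ z * dotg (ν (η - δ)) z) +
        (Nat.choose (η - 1) (δ - 1) : ℂ) * ((η - δ : ℕ) : ℂ) *
          (Ψ δ z * dotg (ν (η - δ - 1)) z))) := by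
    have hev : dotg (ν η) =ᶠ[𝓝 z] fun w => ∑ δ ∈ Finset.Icc 1 η,
        (Nat.choose (η - 1) (δ - 1) : ℂ) * Ψ δ w * dotg (ν (η - δ)) w := by
      filter_upwards [hΩo.mem_nhds hz] with w hw using hΨ η hη hN w hw
    rw [Lop_congr a ζ hev, Lop_sum a ζ _ (F := fun δ w =>
      (Nat.choose (η - 1) (δ - 1) : ℂ) * Ψ δ w * dotg (ν (η - δ)) w) fun δ hδ =>
      ((differentiableAt_const _).mul (hd δ hδ)).mul (differentiable_dotg _ z)]
    refine Finset.sum_congr rfl fun δ hδ => ?_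
    rw [Lop_mul a ζ (F := fun w => (Nat.choose (η - 1) (δ - 1) : ℂ) * Ψ δ w)
        ((differentiableAt_const _).mul (hd δ hδ)) (differentiable_dotg _ z),
      Lop_mul a ζ (differentiableAt_const _) (hd δ hδ), Lop_const,
      hL (η - δ) ((Nat.sub_le _ _).trans hN)]
    ring
  rw [hL η hN, Finset.sum_add_distrib, Finset.sum_add_distrib, ← Finset.mul_sum,
    ← hΨ η hη hN z hz] at hLη
  obtain ⟨k, rfl⟩ : ∃ k, η = k + 1 := ⟨η - 1, by omega⟩
  have hk : ∑ δ ∈ Finset.Icc 1 (k + 1), (Nat.choose (k + 1 - 1) (δ - 1) : ℂ) *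
      ((k + 1 - δ : ℕ) : ℂ) * (Ψ δ z * dotg (ν (k + 1 - δ - 1)) z) =
      k * dotg (ν k) z := by
    rw [Finset.sum_Icc_succ_top (by omega), Nat.sub_self, Nat.cast_zero, mul_zero, zero_mul,
      add_zero]
    rcases Nat.eq_zero_or_pos k with rfl | hk0
    · simp
    · rw [hΨ k hk0 (by omega) z hz, Finset.mul_sum]
      refine Finset.sum_congr rfl fun δ hδ => ?_
      rw [Finset.mem_Icc] at hδ
      rw [choose_pred_mul_sub hδ.1 hδ.2, show k + 1 - δ - 1 = k - δ by omega]
      ring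
  rw [hk] at hLη
  push_cast at hLη
  simp only [Nat.add_sub_cancel] at hLη ⊢
  linear_combination -hLη

end LinearSystem

/-- **Lemma 2.2.** Let the system (2.25) be Jacobian, let `ν⁰` be a nonzero
common eigenvector of `A₁,…,A_m` with `A_j ν⁰ = λ^j ν⁰`, fix `ζ` and `s ≥ 2`,
and let `ν^η` (`η = 1,…,s−1`) be generalized eigenvectors of `A_ζ`:
`(A_ζ − λ^ζ I) ν^η = η ν^{η−1}`.  Let `Ω ⊆ {ν⁰·γ ≠ 0}` be a domain and let
`Ψ_η` solve the triangular system
`ν^η·γ = ∑_{δ=1}^{η} C(η−1,δ−1) Ψ_δ (ν^{η−δ}·γ)` on `Ω`.  If none of the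
functions `𝔏_j Ψ_η` (`j ≠ ζ`) is a nonconstant first integral of
`𝔏_ζ w = 0` on `Ω`, then `𝔏_ζ Ψ₁ = 1`, `𝔏_ζ Ψ_η = 0` for `η = 2,…,s−1`,
and each `𝔏_j Ψ_η` (`j ≠ ζ`) is constant on `Ω`. -/
theorem statement_18 {n m : ℕ}
    (a : Fin m → (Fin n ⊕ Fin n) → (Fin n ⊕ Fin n) → ℂ)
    (hJac : Jacobian a)
    (ζ : Fin m) (s : ℕ) (hs : 2 ≤ s)
    (ν : ℕ → Fin n ⊕ Fin n → ℂ) (hν0 : ν 0 ≠ 0)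
    (lam : Fin m → ℂ)
    (heig : ∀ j, Amap a j (ν 0) = lam j • ν 0)
    (hgen : ∀ η, 1 ≤ η → η ≤ s - 1 →
      Amap a ζ (ν η) = lam ζ • ν η + (η : ℂ) • ν (η - 1))
    (Ω : Set (Fin n → ℂ)) (hΩo : IsOpen Ω) (hΩc : IsConnected Ω)
    (hΩsub : Ω ⊆ {z | dotg (ν 0) z ≠ 0})
    (Ψ : ℕ → (Fin n → ℂ) → ℂ)
    (hΨ : ∀ η, 1 ≤ η → η ≤ s - 1 → ∀ z ∈ Ω,
      dotg (ν η) z = ∑ δ ∈ Finset.Icc 1 η,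
        (Nat.choose (η - 1) (δ - 1) : ℂ) * Ψ δ z * dotg (ν (η - δ)) z)
    (hnotFI : ∀ j, j ≠ ζ → ∀ η, 1 ≤ η → η ≤ s - 1 →
      (∀ z ∈ Ω, Lop a ζ (Lop a j (Ψ η)) z = 0) →
      ∃ cst : ℂ, ∀ z ∈ Ω, Lop a j (Ψ η) z = cst) :
    (∀ z ∈ Ω, Lop a ζ (Ψ 1) z = 1) ∧
    (∀ η, 2 ≤ η → η ≤ s - 1 → ∀ z ∈ Ω, Lop a ζ (Ψ η) z = 0) ∧
    (∀ j, j ≠ ζ → ∀ η, 1 ≤ η → η ≤ s - 1 →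
      ∃ cst : ℂ, ∀ z ∈ Ω, Lop a j (Ψ η) z = cst) := by
  have hΩ0 : ∀ z ∈ Ω, dotg (ν 0) z ≠ 0 := fun z hz => hΩsub hz
  have hsm : ∀ η, 1 ≤ η → η ≤ s - 1 → ContDiffOn ℝ (⊤ : ℕ∞) (Ψ η) Ω :=
    contDiffOn_of_triangular hΩ0 hΨ
  have hsum : ∀ η, 1 ≤ η → η ≤ s - 1 → ∀ z ∈ Ω, _ := fun η h1 h2 z hz =>
    sum_choose_mul_Lop a (heig ζ) hgen hΩo
      (fun η h1 h2 => (hsm η h1 h2).differentiableOn (by simp)) hΨ h1 h2 hz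
  have hone : ∀ z ∈ Ω, Lop a ζ (Ψ 1) z = 1 := fun z hz => by
    have h := hsum 1 le_rfl (by omega) z hz
    simpa [hΩ0 z hz] using h
  have hzero : ∀ η, 2 ≤ η → η ≤ s - 1 → ∀ z ∈ Ω, Lop a ζ (Ψ η) z = 0 := by
    intro η
    induction η using Nat.strong_induction_on with
    | _ η ih =>
      intro h2 hs1 z hz
      obtain ⟨k, rfl⟩ : ∃ k, η = k + 2 := ⟨η - 2, by omega⟩
      have h := hsum (k + 2) (by omega) hs1 z hz
      rw [Finset.sum_Icc_succ_top (by omega),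
        Finset.sum_eq_single_of_mem 1 (by simp) fun δ hδ hδ1 => by
          rw [Finset.mem_Icc] at hδ
          rw [ih δ (by omega) (by omega) (by omega) z hz, mul_zero, zero_mul]] at h
      simpa [hone z hz, hΩ0 z hz] using h
  refine ⟨hone, hzero, fun j hj η h1 h2 => hnotFI j hj η h1 h2 fun z hz => ?_⟩
  obtain ⟨c, hc⟩ : ∃ c : ℂ, ∀ w ∈ Ω, Lop a ζ (Ψ η) w = c := by
    rcases h1.eq_or_lt with rfl | h
    · exact ⟨1, hone⟩
    · exact ⟨0, hzero η h h2⟩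
  rw [hJac.comm_of_contDiffOn ζ j hΩo (hsm η h1 h2) hz,
    Lop_congr a j (G := fun _ => c) (Filter.eventually_of_mem (hΩo.mem_nhds hz) hc), Lop_const]
end
end
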